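/- Let n ≥ 3, m ≥ 1 and (n+2)/(n−2) < p < p_c(n), where p_c(n) = ∞ for n ≤ 10 and p_c(n) = ((n−2)² − 4n + 8√(n−1)) / ((n−2)(n−10)) for n ≥ 11. Let ψ_1,…,ψ_m be C² functions on the unit sphere S^{n−1} and set u_i(x) = |x|^{−2/(p−1)} ψ_i(x/|x|). If u = (u_1,…,u_m) satisfies −Δu_i = |u|^{p−1} u_i on ℝⁿ ∖ {0} for each i and the stability inequality Σ_i ∫ |u|^{p−1} φ_i² + (p−1) Σ_{i,j} ∫ |u|^{p−3} u_i u_j φ_i φ_j ≤ Σ_i ∫ |∇φ_i|² holds for all φ_1,…,φ_m ∈ C_c^∞(ℝⁿ ∖ {0}), then ψ_i ≡ 0 for every i. -/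

import Mathlib

open MeasureTheory Metric Filter Real Set

noncomputable section

/-- `n`-dimensional Euclidean space. -/
abbrev Euc (n : ℕ) := EuclideanSpace ℝ (Fin n)

/-- Laplacian of a scalar function on Euclidean space. -/
def lap {n : ℕ} (f : Euc n → ℝ) (x : Euc n) : ℝ :=
  ∑ i : Fin n, iteratedFDeriv ℝ 2 f x ![EuclideanSpace.single i 1, EuclideanSpace.single i 1]

/-- Stability (quadratic form) inequality for the second order Lane–Emden system, tested
against families of smooth compactly supported functions whose supports lie in `S`:
`Σ_i ∫ |u|^{p−1} φ_i² + (p−1) Σ_{i,j} ∫ |u|^{p−3} u_i u_j φ_i φ_j ≤ Σ_i ∫ |∇φ_i|²`.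
(Since `‖u x‖ ^ (p−3)` is interpreted with `Real.rpow`, the term `|u|^{p−3} u_i u_j`
vanishes on the set where `u = 0`, for any `p > 1`.) -/
def Stable1 (n m : ℕ) (p : ℝ) (u : Euc n → EuclideanSpace ℝ (Fin m))
    (S : Set (Euc n)) : Prop :=
  ∀ φ : Fin m → Euc n → ℝ,
    (∀ i, ContDiff ℝ (⊤ : ℕ∞) (φ i)) → (∀ i, HasCompactSupport (φ i)) →
    (∀ i, tsupport (φ i) ⊆ S) →
    (∑ i, ∫ x, ‖u x‖ ^ (p - 1) * (φ i x) ^ 2) +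
      (p - 1) * ∑ i, ∑ j, ∫ x, ‖u x‖ ^ (p - 3) * u x i * u x j * φ i x * φ j x
      ≤ ∑ i, ∫ x, ‖gradient (φ i) x‖ ^ 2

open scoped Topology Convolution

/-- A compactly supported `C¹` function is a `C¹`-uniform limit of smooth functions, with supports
in a common compact set. -/
theorem exists_contDiff_approx {E : Type*} [NormedAddCommGroup E] [NormedSpace ℝ E]
    [FiniteDimensional ℝ E] {U : Set E} (hU : IsOpen U) {g : E → ℝ} (hg : ContDiff ℝ 1 g)
    (hc : HasCompactSupport g) (hgU : tsupport g ⊆ U) :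
    ∃ K, IsCompact K ∧ K ⊆ U ∧ tsupport g ⊆ K ∧ ∀ ε > 0, ∃ f : E → ℝ, ContDiff ℝ (⊤ : ℕ∞) f ∧
      tsupport f ⊆ K ∧ (∀ x, |f x - g x| ≤ ε) ∧ ∀ x, ‖fderiv ℝ f x - fderiv ℝ g x‖ ≤ ε := by
  let _ : MeasurableSpace E := borel E
  have : BorelSpace E := ⟨rfl⟩
  let μ : Measure E := Measure.addHaar
  obtain ⟨δ₀, hδ₀, hK⟩ := hc.isCompact.exists_cthickening_subset_open hU hgU
  refine ⟨cthickening δ₀ (tsupport g), hc.isCompact.cthickening, hK,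
    self_subset_cthickening _, fun ε hε => ?_⟩
  have hg' : Continuous (fderiv ℝ g) := hg.continuous_fderiv one_ne_zero
  obtain ⟨δ₁, hδ₁, h₁⟩ := Metric.uniformContinuous_iff.1
    (hc.uniformContinuous_of_continuous hg.continuous) ε hε
  obtain ⟨δ₂, hδ₂, h₂⟩ := Metric.uniformContinuous_iff.1
    ((hc.fderiv (𝕜 := ℝ)).uniformContinuous_of_continuous hg') ε hε
  have hδ : 0 < min δ₀ (min δ₁ δ₂) := by positivity
  let b : ContDiffBump (0 : E) := ⟨min δ₀ (min δ₁ δ₂) / 2, min δ₀ (min δ₁ δ₂), by positivity,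
    by linarith⟩
  have hb : b.rOut = min δ₀ (min δ₁ δ₂) := rfl
  have hbl : LocallyIntegrable (b.normed μ) μ := b.continuous_normed.locallyIntegrable
  refine ⟨b.normed μ ⋆[ContinuousLinearMap.lsmul ℝ ℝ, μ] g, ?_, ?_, fun x => ?_, fun x => ?_⟩
  · exact b.hasCompactSupport_normed.contDiff_convolution_left _ b.contDiff_normed
      hg.continuous.locallyIntegrable
  · refine closure_minimal (fun x hx => ?_) isClosed_cthickening
    by_contra hxK
    refine hx ?_
    have h0 : ∀ y ∈ ball x b.rOut, g y = 0 := fun y hy => by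
      by_contra hy0
      refine hxK (mem_cthickening_of_dist_le x y δ₀ _ (subset_tsupport _ hy0) ?_)
      rw [dist_comm]
      exact (mem_ball.1 hy).le.trans (min_le_left _ _)
    have hx0 := h0 x (mem_ball_self b.rOut_pos)
    rw [b.normed_convolution_eq_right fun y hy => by rw [h0 y hy, hx0], hx0]
  · rw [← Real.dist_eq]
    refine b.dist_normed_convolution_le hg.continuous.aestronglyMeasurable fun y hy => ?_
    refine (h₁ (lt_of_lt_of_le (mem_ball.1 hy) ?_)).le
    exact (min_le_right _ _).trans (min_le_left _ _)
  · rw [(hc.hasFDerivAt_convolution_right (ContinuousLinearMap.lsmul ℝ ℝ) hbl hg x).fderiv,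
      ← dist_eq_norm]
    have hL : (ContinuousLinearMap.lsmul ℝ ℝ : ℝ →L[ℝ] ℝ →L[ℝ] ℝ).precompR E =
        ContinuousLinearMap.lsmul ℝ ℝ := by
      ext; simp
    rw [hL]
    refine b.dist_normed_convolution_le hg'.aestronglyMeasurable fun y hy => ?_
    refine (h₂ (lt_of_lt_of_le (mem_ball.1 hy) ?_)).le
    exact (min_le_right _ _).trans (min_le_right _ _)

/-- Dominated convergence against a weight that is continuous on a compact set carrying all the
functions involved. -/
theorem tendsto_integral_mul_of_compact {E : Type*} [TopologicalSpace E] [T2Space E]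
    [MeasurableSpace E] [OpensMeasurableSpace E] [SecondCountableTopology E]
    {μ : Measure E} [IsFiniteMeasureOnCompacts μ]
    {K : Set E} (hK : IsCompact K) {a : E → ℝ} (ha : ContinuousOn a K) {F : ℕ → E → ℝ}
    {G : E → ℝ} (hF : ∀ k, Continuous (F k)) (hFK : ∀ k, ∀ x ∉ K, F k x = 0)
    (hGK : ∀ x ∉ K, G x = 0) {C : ℝ} (hC : ∀ k x, |F k x| ≤ C)
    (hlim : ∀ x, Tendsto (fun k => F k x) atTop (𝓝 (G x))) :
    Tendsto (fun k => ∫ x, a x * F k x ∂μ) atTop (𝓝 (∫ x, a x * G x ∂μ)) := by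
  have h₁ : ∀ k, ∫ x, a x * F k x ∂μ = ∫ x in K, a x * F k x ∂μ := fun k =>
    (setIntegral_eq_integral_of_forall_compl_eq_zero fun x hx => by simp [hFK k x hx]).symm
  have h₂ : ∫ x, a x * G x ∂μ = ∫ x in K, a x * G x ∂μ :=
    (setIntegral_eq_integral_of_forall_compl_eq_zero fun x hx => by simp [hGK x hx]).symm
  simp_rw [h₁, h₂]
  obtain ⟨A, hA⟩ := hK.exists_bound_of_continuousOn ha
  have : IsFiniteMeasure (μ.restrict K) := ⟨by simpa using hK.measure_lt_top⟩
  refine tendsto_integral_of_dominated_convergence (fun _ => A * C) (fun k => ?_)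
    (integrable_const _) (fun k => ?_) (.of_forall fun x => (hlim x).const_mul _)
  · exact (ha.mul (hF k).continuousOn).aestronglyMeasurable hK.measurableSet
  · filter_upwards [ae_restrict_mem hK.measurableSet] with x hx
    rw [norm_mul]
    exact mul_le_mul (hA x hx) (hC k x) (norm_nonneg _) ((norm_nonneg _).trans (hA x hx))

/-- The integral of a directional derivative of a compactly supported `C¹` function vanishes. -/
theorem integral_fderiv_apply_eq_zero {E : Type*} [NormedAddCommGroup E] [NormedSpace ℝ E]
    [FiniteDimensional ℝ E] [MeasurableSpace E] [BorelSpace E] {μ : Measure E}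
    [μ.IsAddHaarMeasure] {g : E → ℝ} (hg : ContDiff ℝ 1 g) (hc : HasCompactSupport g) (v : E) :
    ∫ x, fderiv ℝ g x v ∂μ = 0 := by
  have hi : Integrable (fun x => fderiv ℝ g x v) μ :=
    ((hg.continuous_fderiv one_ne_zero).clm_apply continuous_const).integrable_of_hasCompactSupport
      (hc.fderiv_apply (𝕜 := ℝ) v)
  have := integral_mul_fderiv_eq_neg_fderiv_mul_of_integrable (μ := μ) (f := fun _ : E => (1 : ℝ))
    (g := g) (v := v) (by simp) (by simpa using hi)
    (by simpa using hg.continuous.integrable_of_hasCompactSupport hc)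
    (by fun_prop) (fun x _ => hg.differentiable one_ne_zero x)
  simpa using this

/-- Polar coordinates for a function homogeneous of degree `-d` times a function of `log ‖x‖`. -/
theorem exists_integral_homogeneous_mul_log {E : Type*} [NormedAddCommGroup E] [NormedSpace ℝ E]
    [FiniteDimensional ℝ E] [Nontrivial E] [MeasurableSpace E] [BorelSpace E] (μ : Measure E)
    [μ.IsAddHaarMeasure] {W : E → ℝ}
    (hW : ∀ t : ℝ, 0 < t → ∀ x, W (t • x) = t ^ (-(Module.finrank ℝ E : ℝ)) * W x) :
    ∃ M : ℝ, ∀ h : ℝ → ℝ, ∫ x, W x * h (log ‖x‖) ∂μ = M * ∫ s, h s := by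
  refine ⟨∫ θ : sphere (0 : E) 1, W θ ∂μ.toSphere, fun h => ?_⟩
  set d := Module.finrank ℝ E with hd
  have hdpos : 0 < d := Module.finrank_pos
  have h₁ : ∫ x, W x * h (log ‖x‖) ∂μ =
      ∫ x : ({(0 : E)}ᶜ : Set E), W x * h (log ‖(x : E)‖) ∂(μ.comap (↑)) := by
    rw [integral_subtype_comap (measurableSet_singleton _).compl
      fun x : E => W x * h (log ‖x‖), restrict_compl_singleton]
  have h₂ : ∫ x : ({(0 : E)}ᶜ : Set E), W x * h (log ‖(x : E)‖) ∂(μ.comap (↑)) =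
      ∫ z : sphere (0 : E) 1 × Ioi (0 : ℝ), W z.1 * ((z.2 : ℝ) ^ (-(d : ℝ)) * h (log z.2))
        ∂(μ.toSphere.prod (.volumeIoiPow (d - 1))) := by
    rw [← μ.measurePreserving_homeomorphUnitSphereProd.integral_comp
      (Homeomorph.measurableEmbedding _)]
    congr 1 with x
    have hx : 0 < ‖(x : E)‖ := norm_pos_iff.2 x.2
    have : W (x : E) = W (‖(x : E)‖ • (‖(x : E)‖⁻¹ • (x : E))) := by
      rw [smul_smul, mul_inv_cancel₀ hx.ne', one_smul]
    rw [this, hW _ hx]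
    simp only [homeomorphUnitSphereProd_apply_fst_coe, homeomorphUnitSphereProd_apply_snd_coe]
    ring
  rw [h₁, h₂, integral_prod_mul (fun θ : sphere (0 : E) 1 => W θ)
    fun r : Ioi (0 : ℝ) => (r : ℝ) ^ (-(d : ℝ)) * h (log r)]
  congr 1
  simp only [Measure.volumeIoiPow, ENNReal.ofReal]
  rw [integral_withDensity_eq_integral_smul (by fun_prop),
    integral_subtype_comap measurableSet_Ioi fun a : ℝ =>
      Real.toNNReal (a ^ (d - 1)) • (a ^ (-(d : ℝ)) * h (log a))]
  have himg : Real.exp '' univ = Ioi 0 := by rw [image_univ, Real.range_exp]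
  rw [← himg, integral_image_eq_integral_abs_deriv_smul MeasurableSet.univ
    (fun x _ => (Real.hasDerivAt_exp x).hasDerivWithinAt) Real.exp_injective.injOn]
  rw [setIntegral_univ]
  congr 1 with s
  rw [NNReal.smul_def, Real.coe_toNNReal _ (by positivity), log_exp, abs_exp, smul_eq_mul,
    smul_eq_mul, ← Real.exp_nat_mul, ← Real.exp_mul, ← mul_assoc, ← mul_assoc, ← Real.exp_add,
    ← Real.exp_add, Nat.cast_pred hdpos]
  ring_nf
  simp

/-- Slowly varying smooth bumps on the positive half-line. -/
theorem exists_slow_bump {δ : ℝ} (hδ : 0 < δ) :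
    ∃ η : ℝ → ℝ, ∃ b : ℝ, ContDiff ℝ (⊤ : ℕ∞) η ∧ Function.support η ⊆ Icc 1 b ∧
      0 < ∫ s, η s ^ 2 ∧ ∫ s, deriv η s ^ 2 < δ * ∫ s, η s ^ 2 := by
  let χ : ContDiffBump (0 : ℝ) := ⟨1, 2, by norm_num, by norm_num⟩
  have hχ : ContDiff ℝ (⊤ : ℕ∞) χ := χ.contDiff
  have hpos : 0 < ∫ s, χ s ^ 2 := by
    refine (χ.continuous.pow 2).integral_pos_of_hasCompactSupport_nonneg_nonzero
      (χ.hasCompactSupport.comp_left (g := fun y : ℝ => y ^ 2) (by simp))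
      (fun s => sq_nonneg _) (x := 0) ?_
    simp [χ.one_of_mem_closedBall (x := 0) (by simp [χ])]
  set P := ∫ s, χ s ^ 2
  set Q := ∫ s, deriv χ s ^ 2
  obtain ⟨k, hk⟩ := exists_nat_gt (Q / (δ * P))
  set R : ℝ := k + 1
  have hR : 1 ≤ R := by simp [R]
  have hR0 : 0 < R := by linarith
  have hQ : Q < δ * P * R ^ 2 := by
    have h1 : Q / (δ * P) < R ^ 2 := by nlinarith
    rwa [div_lt_iff₀ (by positivity), mul_comm] at h1
  have hd : ∀ s, deriv (fun s => χ (R⁻¹ * s - R⁻¹ * (2 * R + 1))) s =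
      R⁻¹ * deriv χ (R⁻¹ * s - R⁻¹ * (2 * R + 1)) := fun s => by
    have h1 : HasDerivAt (fun s : ℝ => R⁻¹ * s - R⁻¹ * (2 * R + 1)) R⁻¹ s := by
      simpa using ((hasDerivAt_id s).const_mul R⁻¹).sub_const (R⁻¹ * (2 * R + 1))
    have h2 := ((hχ.differentiable (by simp)) (R⁻¹ * s - R⁻¹ * (2 * R + 1))).hasDerivAt
    exact (h2.comp s h1).deriv.trans (mul_comm _ _)
  have hint : ∀ f : ℝ → ℝ, ∫ s, f (R⁻¹ * s - R⁻¹ * (2 * R + 1)) = R * ∫ s, f s := fun f => by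
    rw [Measure.integral_comp_mul_left (fun s => f (s - R⁻¹ * (2 * R + 1))),
      integral_sub_right_eq_self f, inv_inv, abs_of_pos hR0, smul_eq_mul]
  refine ⟨fun s => χ (R⁻¹ * s - R⁻¹ * (2 * R + 1)), 4 * R + 1, ?_, ?_, ?_, ?_⟩
  · exact hχ.comp (by fun_prop)
  · intro s hs
    have h1 : R⁻¹ * s - R⁻¹ * (2 * R + 1) ∈ Function.support χ := hs
    rw [χ.support_eq, mem_ball_zero_iff, Real.norm_eq_abs, ← mul_sub, abs_mul, abs_inv,
      abs_of_pos hR0, inv_mul_lt_iff₀ hR0] at h1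
    have h2 := abs_lt.1 (h1 : _ < R * 2)
    constructor <;> linarith
  · rw [hint fun s => χ s ^ 2]
    positivity
  · simp_rw [hd, mul_pow]
    rw [integral_const_mul, hint fun s => deriv χ s ^ 2, hint fun s => χ s ^ 2]
    have : (R⁻¹) ^ 2 * (R * Q) = Q / R := by field_simp
    rw [this, div_lt_iff₀ hR0]
    nlinarith

/-- The cross term integrates to zero. -/
theorem integral_deriv_sub_smul_sq {η : ℝ → ℝ} (hη : ContDiff ℝ 1 η)
    (hc : HasCompactSupport η) (c : ℝ) :
    ∫ s, (deriv η s - c * η s) ^ 2 = (∫ s, deriv η s ^ 2) + c ^ 2 * ∫ s, η s ^ 2 := by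
  have hd : Continuous (deriv η) := hη.continuous_deriv le_rfl
  have hη0 := hη.continuous
  have hcd : HasCompactSupport (deriv η) := hc.deriv
  have i1 : Integrable fun s => deriv η s ^ 2 := by
    simp_rw [sq]
    exact (hd.mul hd).integrable_of_hasCompactSupport hcd.mul_right
  have i2 : Integrable fun s => η s ^ 2 := by
    simp_rw [sq]
    exact (hη0.mul hη0).integrable_of_hasCompactSupport hc.mul_right
  have i3 : Integrable fun s => η s * deriv η s :=
    (hη0.mul hd).integrable_of_hasCompactSupport hc.mul_right
  have h0 : ∫ s, (deriv η s * η s + η s * deriv η s) = 0 := by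
    refine integral_eq_zero_of_hasDerivAt_of_integrable (f := fun s => η s * η s)
      (fun s => ?_) ?_ ?_
    · have := (hη.differentiable one_ne_zero s).hasDerivAt
      exact this.mul this
    · exact (i3.add i3).congr (.of_forall fun s => by simp [mul_comm])
    · simpa only [sq] using i2
  have h0' : ∫ s, η s * deriv η s = 0 := by
    have : ∀ s, deriv η s * η s + η s * deriv η s = 2 * (η s * deriv η s) := fun s => by ring
    simp_rw [this] at h0
    rw [integral_const_mul] at h0
    linarith
  have : ∀ s, (deriv η s - c * η s) ^ 2 =
      (deriv η s ^ 2 + c ^ 2 * η s ^ 2) - 2 * c * (η s * deriv η s) := fun s => by ring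
  simp_rw [this]
  have i4 : Integrable fun s => deriv η s ^ 2 + c ^ 2 * η s ^ 2 := i1.add (i2.const_mul _)
  rw [integral_sub i4 (i3.const_mul _), integral_add i1 (i2.const_mul _),
    integral_const_mul, integral_const_mul, h0']
  ring

/-- The Joseph–Lundgren condition. -/
theorem joseph_lundgren {n : ℕ} (hn : 3 ≤ n) {p : ℝ} (hp1 : ((n : ℝ) + 2) / ((n : ℝ) - 2) < p)
    (hp2 : 11 ≤ n →
      p < (((n : ℝ) - 2) ^ 2 - 4 * (n : ℝ) + 8 * Real.sqrt ((n : ℝ) - 1)) /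
          (((n : ℝ) - 2) * ((n : ℝ) - 10))) :
    p * (((n : ℝ) - 2) / 2 - 2 / (p - 1)) ^ 2 < (p - 1) * (((n : ℝ) - 2) / 2) ^ 2 := by
  have hn3 : (3 : ℝ) ≤ n := by exact_mod_cast hn
  obtain ⟨q, rfl⟩ : ∃ q, p = q + 1 := ⟨p - 1, by ring⟩
  obtain ⟨N, hN⟩ : ∃ N : ℝ, N = n - 2 := ⟨_, rfl⟩
  have hnN : (n : ℝ) = N + 2 := by linarith
  rw [hnN] at hp1 hp2 ⊢
  have hN1 : 1 ≤ N := by linarith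
  have hNq : 4 < N * q := by
    rw [div_lt_iff₀ (by linarith)] at hp1
    nlinarith
  have hq : 0 < q := by
    by_contra hq
    nlinarith
  have key : N * (N - 8) * q ^ 2 - 8 * (N - 2) * q + 16 < 0 := by
    rcases le_or_gt n 10 with h10 | h11
    · have hn10 : (n : ℝ) ≤ 10 := by exact_mod_cast h10
      have hN8 : N ≤ 8 := by linarith
      have h1 : N * (N - 8) * q ^ 2 ≤ 4 * (N - 8) * q := by
        nlinarith [mul_nonneg (sub_nonneg.2 hN8) (mul_pos hq (sub_pos.2 hNq)).le]
      nlinarith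
    · have hn11 : (11 : ℝ) ≤ n := by exact_mod_cast h11
      have hN9 : 9 ≤ N := by linarith
      have h2 := hp2 h11
      set S := Real.sqrt (N + 2 - 1) with hS
      have hS2 : S ^ 2 = N + 1 := by rw [hS, Real.sq_sqrt (by linarith)]; ring
      have hS0 : 0 ≤ S := Real.sqrt_nonneg _
      rw [lt_div_iff₀ (by nlinarith)] at h2
      have h3 : N * (N - 8) * q < 4 * (N - 2) + 8 * S := by nlinarith
      have h4 : 4 * (N - 2) - 8 * S < N * (N - 8) * q := by
        have : 3 ≤ S := by nlinarith
        nlinarith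
      have h5 : 0 < N * (N - 8) := by nlinarith
      have h6 : (N * (N - 8) * q - (4 * (N - 2) - 8 * S)) *
          ((4 * (N - 2) + 8 * S) - N * (N - 8) * q) > 0 :=
        mul_pos (by linarith) (by linarith)
      have h7 : N * (N - 8) * (N * (N - 8) * q ^ 2 - 8 * (N - 2) * q + 16) < 0 := by
        nlinarith
      by_contra h8
      nlinarith [mul_nonneg h5.le (not_lt.1 h8)]
  have e : (q + 1 - 1) * ((N + 2 - 2) / 2) ^ 2 -
      (q + 1) * ((N + 2 - 2) / 2 - 2 / (q + 1 - 1)) ^ 2 =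
      -(N * (N - 8) * q ^ 2 - 8 * (N - 2) * q + 16) / (4 * q ^ 2) := by
    have : q + 1 - 1 = q := by ring
    rw [this]
    field_simp
    ring
  have : 0 < -(N * (N - 8) * q ^ 2 - 8 * (N - 2) * q + 16) / (4 * q ^ 2) := by
    apply div_pos <;> [linarith; positivity]
  linarith

/-- A function is `Cᵏ` if it is `Cᵏ` at each point of its topological support. -/
theorem contDiff_of_contDiffAt_tsupport {E : Type*} [NormedAddCommGroup E] [NormedSpace ℝ E]
    {k : WithTop ℕ∞} {g : E → ℝ} (h : ∀ x ∈ tsupport g, ContDiffAt ℝ k g x) :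
    ContDiff ℝ k g := by
  refine contDiff_iff_contDiffAt.2 fun x => ?_
  by_cases hx : x ∈ tsupport g
  · exact h x hx
  · exact contDiffAt_const.congr_of_eventuallyEq (notMem_tsupport_iff_eventuallyEq.1 hx)

/-- A function continuous on a compact set and vanishing off it is integrable. -/
theorem integrable_of_continuousOn_compact {E : Type*} [TopologicalSpace E] [T2Space E]
    [MeasurableSpace E] [OpensMeasurableSpace E] {μ : Measure E}
    [IsFiniteMeasureOnCompacts μ] {K : Set E} (hK : IsCompact K) {a : E → ℝ}
    (ha : ContinuousOn a K) (h0 : ∀ x ∉ K, a x = 0) : Integrable a μ := by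
  refine (integrableOn_iff_integrable_of_support_subset (s := K) fun x hx => ?_).1
    (ha.integrableOn_compact' hK hK.measurableSet)
  by_contra h
  exact hx (h0 x h)

theorem norm_gradient_sq {n : ℕ} (f : Euc n → ℝ) (x : Euc n) :
    ‖gradient f x‖ ^ 2 = ∑ k, (fderiv ℝ f x (EuclideanSpace.single k 1)) ^ 2 := by
  rw [EuclideanSpace.real_norm_sq_eq]
  refine Finset.sum_congr rfl fun k _ => ?_
  rw [← inner_gradient_left, EuclideanSpace.inner_single_right]
  simp

theorem norm_gradient_eq_norm_fderiv {n : ℕ} (f : Euc n → ℝ) (x : Euc n) :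
    ‖gradient f x‖ = ‖fderiv ℝ f x‖ := by
  simp [gradient]

/-- The derivative in the direction `x` is controlled by the gradient. -/
theorem sq_fderiv_self_div_le {n : ℕ} (f : Euc n → ℝ) (x : Euc n) :
    (fderiv ℝ f x x) ^ 2 / ‖x‖ ^ 2 ≤ ‖gradient f x‖ ^ 2 := by
  refine div_le_of_le_mul₀ (sq_nonneg _) (sq_nonneg _) ?_
  rw [← mul_pow, ← inner_gradient_left, sq_le_sq, abs_of_nonneg (by positivity : 0 ≤ _ * ‖x‖)]
  exact abs_real_inner_le_norm _ _

theorem continuous_norm_rpow_mul_mul {m : ℕ} {p : ℝ} (hp : 1 < p) (i j : Fin m) :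
    Continuous fun y : EuclideanSpace ℝ (Fin m) => ‖y‖ ^ (p - 3) * y i * y j := by
  refine continuous_iff_continuousAt.2 fun y => ?_
  have hi : ∀ i : Fin m, Continuous fun y : EuclideanSpace ℝ (Fin m) => y i := fun i => by fun_prop
  rcases eq_or_ne y 0 with rfl | hy
  · have h1 : Tendsto (fun y : EuclideanSpace ℝ (Fin m) => ‖y‖ ^ (p - 1)) (𝓝 0) (𝓝 0) := by
      have : Continuous fun y : EuclideanSpace ℝ (Fin m) => ‖y‖ ^ (p - 1) :=
        continuous_norm.rpow_const fun _ => Or.inr (by linarith)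
      simpa [Real.zero_rpow (by linarith : p - 1 ≠ 0)] using this.tendsto 0
    have h2 : Tendsto (fun y : EuclideanSpace ℝ (Fin m) => ‖y‖ ^ (p - 3) * y i * y j)
        (𝓝 0) (𝓝 0) := by
      refine squeeze_zero_norm (fun y => ?_) h1
      rcases eq_or_ne y 0 with rfl | hy
      · simp [Real.zero_rpow (by linarith : p - 1 ≠ 0)]
      · have hy' : 0 < ‖y‖ := norm_pos_iff.2 hy
        have : ‖y‖ ^ (p - 1) = ‖y‖ ^ (p - 3) * ‖y‖ * ‖y‖ := by
          rw [mul_assoc, ← sq, ← Real.rpow_natCast, ← Real.rpow_add hy']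
          norm_num
          ring_nf
        rw [this, norm_mul, norm_mul, Real.norm_of_nonneg (by positivity : 0 ≤ ‖y‖ ^ (p - 3))]
        have h3 := PiLp.norm_apply_le y i
        have h4 := PiLp.norm_apply_le y j
        gcongr
    simpa [ContinuousAt] using h2
  · have : ContinuousAt (fun y : EuclideanSpace ℝ (Fin m) => ‖y‖ ^ (p - 3)) y :=
      continuous_norm.continuousAt.rpow_const (Or.inl (norm_ne_zero_iff.2 hy))
    exact (this.mul (hi i).continuousAt).mul (hi j).continuousAt

/-- The stability inequality extends from smooth to `C¹` test functions. -/
theorem Stable1.le_of_contDiff_one {n m : ℕ} {p : ℝ} (hp : 1 < p)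
    {u : Euc n → EuclideanSpace ℝ (Fin m)} {S : Set (Euc n)} (hS : IsOpen S)
    (hu : ContinuousOn u S) (hstab : Stable1 n m p u S) {φ : Fin m → Euc n → ℝ}
    (hφ : ∀ i, ContDiff ℝ 1 (φ i)) (hc : ∀ i, HasCompactSupport (φ i))
    (hφS : ∀ i, tsupport (φ i) ⊆ S) :
    (∑ i, ∫ x, ‖u x‖ ^ (p - 1) * (φ i x) ^ 2) +
      (p - 1) * ∑ i, ∑ j, ∫ x, ‖u x‖ ^ (p - 3) * u x i * u x j * φ i x * φ j x
      ≤ ∑ i, ∫ x, ‖gradient (φ i) x‖ ^ 2 := by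
  choose K hK hKS hφK happ using fun i => exists_contDiff_approx hS (hφ i) (hc i) (hφS i)
  have hε : ∀ k : ℕ, (0 : ℝ) < 1 / (k + 1) := fun k => by positivity
  choose F hF hFK hF0 hF1 using fun i (k : ℕ) => happ i _ (hε k)
  have hε1 : ∀ k : ℕ, (1 : ℝ) / (k + 1) ≤ 1 := fun k => by
    rw [div_le_one (by positivity)]; simp
  have hφ0 : ∀ i x, x ∉ K i → φ i x = 0 := fun i x hx => image_eq_zero_of_notMem_tsupport
    fun h => hx (hφK i h)
  have hFK0 : ∀ i k x, x ∉ K i → F i k x = 0 := fun i k x hx => image_eq_zero_of_notMem_tsupport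
    fun h => hx (hFK i k h)
  have hlim : ∀ i x, Tendsto (fun k => F i k x) atTop (𝓝 (φ i x)) := fun i x =>
    tendsto_iff_norm_sub_tendsto_zero.2 <|
      squeeze_zero (fun _ => norm_nonneg _) (fun k => hF0 i k x) tendsto_one_div_add_atTop_nhds_zero_nat
  have hlim' : ∀ i x, Tendsto (fun k => fderiv ℝ (F i k) x) atTop (𝓝 (fderiv ℝ (φ i) x)) :=
    fun i x => tendsto_iff_norm_sub_tendsto_zero.2 <|
      squeeze_zero (fun _ => norm_nonneg _) (fun k => hF1 i k x) tendsto_one_div_add_atTop_nhds_zero_nat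
  choose C hC using fun i => (hφ i).continuous.bounded_above_of_compact_support (hc i)
  choose D hD using fun i => ((hφ i).continuous_fderiv one_ne_zero).bounded_above_of_compact_support
    ((hc i).fderiv (𝕜 := ℝ))
  have hFC : ∀ i k x, |F i k x| ≤ C i + 1 := fun i k x => by
    have h1 := hF0 i k x
    have h2 := hC i x
    have h3 := hε1 k
    rw [Real.norm_eq_abs] at h2
    have h4 := abs_sub_abs_le_abs_sub (F i k x) (φ i x)
    linarith
  have hFD : ∀ i k x, ‖fderiv ℝ (F i k) x‖ ≤ D i + 1 := fun i k x => by
    have h1 := hF1 i k x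
    have h2 := hD i x
    have h3 := hε1 k
    have h4 := norm_sub_norm_le (fderiv ℝ (F i k) x) (fderiv ℝ (φ i) x)
    linarith
  have hCnn : ∀ i, 0 ≤ C i + 1 := fun i => (abs_nonneg _).trans (hFC i 0 0)
  have t1 : ∀ i, Tendsto (fun k => ∫ x, ‖u x‖ ^ (p - 1) * (F i k x) ^ 2) atTop
      (𝓝 (∫ x, ‖u x‖ ^ (p - 1) * (φ i x) ^ 2)) := fun i => by
    refine tendsto_integral_mul_of_compact (hK i) ?_ (fun k => (hF i k).continuous.pow 2)
      (fun k x hx => by simp [hFK0 i k x hx]) (fun x hx => by simp [hφ0 i x hx])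
      (C := (C i + 1) ^ 2) (fun k x => ?_) (fun x => (hlim i x).pow 2)
    · exact (hu.mono (hKS i)).norm.rpow_const fun _ _ => Or.inr (by linarith)
    · rw [abs_pow]
      exact pow_le_pow_left₀ (abs_nonneg _) (hFC i k x) 2
  have t2 : ∀ i j, Tendsto
      (fun k => ∫ x, ‖u x‖ ^ (p - 3) * u x i * u x j * F i k x * F j k x) atTop
      (𝓝 (∫ x, ‖u x‖ ^ (p - 3) * u x i * u x j * φ i x * φ j x)) := fun i j => by
    simp_rw [mul_assoc (_ * _ * _) (F i _ _), mul_assoc (_ * _ * _) (φ i _)]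
    refine tendsto_integral_mul_of_compact (hK i) ?_
      (fun k => (hF i k).continuous.mul (hF j k).continuous)
      (fun k x hx => by simp [hFK0 i k x hx]) (fun x hx => by simp [hφ0 i x hx])
      (C := (C i + 1) * (C j + 1)) (fun k x => ?_) (fun x => (hlim i x).mul (hlim j x))
    · exact (continuous_norm_rpow_mul_mul hp i j).comp_continuousOn (hu.mono (hKS i))
    · rw [abs_mul]
      exact mul_le_mul (hFC i k x) (hFC j k x) (abs_nonneg _) (hCnn i)
  have t3 : ∀ i, Tendsto (fun k => ∫ x, ‖gradient (F i k) x‖ ^ 2) atTop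
      (𝓝 (∫ x, ‖gradient (φ i) x‖ ^ 2)) := fun i => by
    simp_rw [norm_gradient_eq_norm_fderiv]
    have := tendsto_integral_mul_of_compact (μ := volume) (hK i) (a := fun _ => 1)
      continuousOn_const
      (F := fun k x => ‖fderiv ℝ (F i k) x‖ ^ 2) (G := fun x => ‖fderiv ℝ (φ i) x‖ ^ 2)
      (C := (D i + 1) ^ 2) (fun k => ((hF i k).continuous_fderiv (by simp)).norm.pow 2)
      (fun k x hx => by simp [fderiv_of_notMem_tsupport ℝ fun h => hx (hFK i k h)])
      (fun x hx => by simp [fderiv_of_notMem_tsupport ℝ fun h => hx (hφK i h)])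
      (fun k x => by
        rw [abs_pow, abs_norm]
        exact pow_le_pow_left₀ (norm_nonneg _) (hFD i k x) 2)
      (fun x => (hlim' i x).norm.pow 2)
    simpa using this
  refine le_of_tendsto_of_tendsto'
    ((tendsto_finsetSum _ fun i _ => t1 i).add
      ((tendsto_finsetSum _ fun i _ => tendsto_finsetSum _ fun j _ => t2 i j).const_mul (p - 1)))
    (tendsto_finsetSum _ fun i _ => t3 i) fun k => ?_
  exact hstab (fun i => F i k) (fun i => hF i k)
    (fun i => HasCompactSupport.of_support_subset_isCompact (hK i)
      ((subset_tsupport _).trans (hFK i k))) fun i => (hFK i k).trans (hKS i)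

theorem fderiv_sq_mul_mul_apply {n : ℕ} {ζ f : Euc n → ℝ} {x : Euc n}
    (hζ : DifferentiableAt ℝ ζ x) (hf : DifferentiableAt ℝ f x)
    (hf' : DifferentiableAt ℝ (fderiv ℝ f) x) (v : Euc n) :
    fderiv ℝ (fun y => ζ y ^ 2 * f y * fderiv ℝ f y v) x v =
      (fderiv ℝ (fun y => ζ y * f y) x v) ^ 2 - f x ^ 2 * (fderiv ℝ ζ x v) ^ 2 +
        ζ x ^ 2 * f x * iteratedFDeriv ℝ 2 f x ![v, v] := by
  have h1 := hζ.hasFDerivAt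
  have h2 := hf.hasFDerivAt
  have h3 : HasFDerivAt (fun y => fderiv ℝ f y v) ((fderiv ℝ (fderiv ℝ f) x).flip v) x := by
    simpa using hf'.hasFDerivAt.clm_apply (hasFDerivAt_const v x)
  have h4 := ((h1.pow 2).mul h2).mul h3
  have h5 := h1.mul h2
  rw [iteratedFDeriv_two_apply, HasFDerivAt.fderiv (f := fun y => ζ y ^ 2 * f y * fderiv ℝ f y v) h4,
    HasFDerivAt.fderiv (f := fun y => ζ y * f y) h5]
  simp
  ring

/-- Energy identity: `∫ |∇(ζ f)|² = -∫ ζ² f Δf + ∫ f² |∇ζ|²`. -/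
theorem integral_norm_gradient_mul_sq {n : ℕ} {U : Set (Euc n)} (hU : IsOpen U)
    {ζ f : Euc n → ℝ} (hζ : ContDiff ℝ 2 ζ) (hc : HasCompactSupport ζ) (hζU : tsupport ζ ⊆ U)
    (hf : ContDiffOn ℝ 2 f U) :
    ∫ x, ‖gradient (fun y => ζ y * f y) x‖ ^ 2 =
      (∫ x, ζ x ^ 2 * f x * -lap f x) + ∫ x, f x ^ 2 * ‖gradient ζ x‖ ^ 2 := by
  have hfat : ∀ x ∈ tsupport ζ, ContDiffAt ℝ 2 f x := fun x hx =>
    hf.contDiffAt (hU.mem_nhds (hζU hx))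
  have hf'at : ∀ x ∈ tsupport ζ, ContDiffAt ℝ 1 (fderiv ℝ f) x := fun x hx =>
    (hfat x hx).fderiv_right (by norm_num)
  set g : Euc n → ℝ := fun y => ζ y * f y with hg
  have hgsupp : tsupport g ⊆ tsupport ζ := tsupport_mul_subset_left
  have hgc : HasCompactSupport g := hc.mul_right
  have hgd : ContDiff ℝ 1 g := contDiff_of_contDiffAt_tsupport fun x hx =>
    (hζ.contDiffAt.mul (hfat x (hgsupp hx))).of_le (by norm_num)
  let V : Fin n → Euc n → ℝ := fun k y =>
    ζ y ^ 2 * f y * fderiv ℝ f y (EuclideanSpace.single k 1)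
  have hVsupp : ∀ k, tsupport (V k) ⊆ tsupport ζ := fun k =>
    closure_mono fun x hx h0 => hx (by simp [V, h0])
  have hVc : ∀ k, HasCompactSupport (V k) := fun k =>
    hc.of_isClosed_subset (isClosed_tsupport _) (hVsupp k)
  have hVd : ∀ k, ContDiff ℝ 1 (V k) := fun k => contDiff_of_contDiffAt_tsupport fun x hx => by
    have hx' := hVsupp k hx
    exact (((hζ.contDiffAt.pow 2).mul (hfat x hx')).of_le (by norm_num)).mul
      ((hf'at x hx').clm_apply contDiffAt_const)
  have hpt : ∀ x, ‖gradient g x‖ ^ 2 = (ζ x ^ 2 * f x * -lap f x + f x ^ 2 * ‖gradient ζ x‖ ^ 2) +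
      ∑ k, fderiv ℝ (V k) x (EuclideanSpace.single k 1) := fun x => by
    by_cases hx : x ∈ tsupport ζ
    · have : ∀ k, fderiv ℝ (V k) x (EuclideanSpace.single k 1) = _ := fun k =>
        fderiv_sq_mul_mul_apply (hζ.differentiable (by norm_num) x)
          ((hfat x hx).differentiableAt (by norm_num))
          ((hf'at x hx).differentiableAt (by norm_num)) (EuclideanSpace.single k 1)
      simp_rw [this]
      rw [norm_gradient_sq, norm_gradient_sq, lap, Finset.sum_add_distrib, Finset.sum_sub_distrib,
        ← Finset.mul_sum, ← Finset.mul_sum]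
      ring
    · have h1 : fderiv ℝ g x = 0 := fderiv_of_notMem_tsupport ℝ fun h => hx (hgsupp h)
      have h2 : fderiv ℝ ζ x = 0 := fderiv_of_notMem_tsupport ℝ hx
      have h3 : ∀ k, fderiv ℝ (V k) x = 0 := fun k =>
        fderiv_of_notMem_tsupport ℝ fun h => hx (hVsupp k h)
      simp [norm_gradient_eq_norm_fderiv, h1, h2, h3, image_eq_zero_of_notMem_tsupport hx]
  have iG : Integrable fun x => ‖gradient g x‖ ^ 2 := by
    simp_rw [norm_gradient_eq_norm_fderiv]
    refine integrable_of_continuousOn_compact hgc.isCompact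
      ((hgd.continuous_fderiv one_ne_zero).norm.pow 2).continuousOn fun x hx => ?_
    simp [fderiv_of_notMem_tsupport ℝ hx]
  have iζ : Integrable fun x => f x ^ 2 * ‖gradient ζ x‖ ^ 2 := by
    simp_rw [norm_gradient_eq_norm_fderiv]
    refine integrable_of_continuousOn_compact hc.isCompact
      (((hf.continuousOn.mono hζU).pow 2).mul
      ((hζ.continuous_fderiv (by norm_num)).norm.pow 2).continuousOn) fun x hx => ?_
    simp [fderiv_of_notMem_tsupport ℝ hx]
  have iV : ∀ k ∈ Finset.univ, Integrable
      fun x => fderiv ℝ (V k) x (EuclideanSpace.single k 1) := fun k _ =>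
    (((hVd k).continuous_fderiv one_ne_zero).clm_apply
      continuous_const).integrable_of_hasCompactSupport ((hVc k).fderiv_apply (𝕜 := ℝ) _)
  have iVs : Integrable fun x => ∑ k, fderiv ℝ (V k) x (EuclideanSpace.single k 1) :=
    integrable_finsetSum _ iV
  have iL : Integrable fun x => ζ x ^ 2 * f x * -lap f x := by
    refine ((iG.sub iVs).sub iζ).congr (.of_forall fun x => ?_)
    simp only [Pi.sub_apply]
    rw [hpt x]
    ring
  simp_rw [hpt]
  have iLζ : Integrable fun x => ζ x ^ 2 * f x * -lap f x + f x ^ 2 * ‖gradient ζ x‖ ^ 2 :=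
    iL.add iζ
  rw [integral_add iLζ iVs, integral_add iL iζ, integral_finsetSum _ iV]
  simp_rw [integral_fderiv_apply_eq_zero (hVd _) (hVc _)]
  simp

theorem hasFDerivAt_comp_log_norm {n : ℕ} {Z : ℝ → ℝ} {x : Euc n} (hx : x ≠ 0)
    (hZ : DifferentiableAt ℝ Z (log ‖x‖)) :
    HasFDerivAt (fun y : Euc n => Z (log ‖y‖))
      ((deriv Z (log ‖x‖) / ‖x‖ ^ 2) • innerSL ℝ x) x := by
  have hx' : 0 < ‖x‖ := norm_pos_iff.2 hx
  have h1 : HasFDerivAt (fun y : Euc n => log ‖y‖) ((‖x‖ ^ 2)⁻¹ • innerSL ℝ x) x := by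
    have h2 := (((hasStrictFDerivAt_norm_sq x).hasFDerivAt).log (by positivity)).const_mul (1 / 2)
    have h3 : (fun y : Euc n => log ‖y‖) = fun y => (1 / 2) * log (‖y‖ ^ 2) := by
      ext y
      rw [Real.log_pow]
      push_cast
      ring
    rw [h3]
    refine h2.congr_fderiv ?_
    rw [← Nat.cast_smul_eq_nsmul ℝ, smul_smul, smul_smul]
    congr 1
    push_cast
    ring
  have h2 := hZ.hasDerivAt.comp_hasFDerivAt x h1
  rw [smul_smul] at h2
  exact h2

/-- The gradient of a function of `log ‖x‖`. -/
theorem norm_gradient_comp_log_norm_sq {n : ℕ} {Z : ℝ → ℝ} {x : Euc n} (hx : x ≠ 0)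
    (hZ : DifferentiableAt ℝ Z (log ‖x‖)) :
    ‖gradient (fun y : Euc n => Z (log ‖y‖)) x‖ ^ 2 = deriv Z (log ‖x‖) ^ 2 / ‖x‖ ^ 2 := by
  have hx' : 0 < ‖x‖ := norm_pos_iff.2 hx
  rw [norm_gradient_eq_norm_fderiv, (hasFDerivAt_comp_log_norm hx hZ).fderiv, norm_smul,
    innerSL_apply_norm, mul_pow, Real.norm_eq_abs, sq_abs]
  field_simp

/-- Smooth functions of `log ‖x‖` supported in `1 ≤ log ‖x‖ ≤ b` are smooth and compactly supported
away from the origin. -/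
theorem contDiff_comp_log_norm {n : ℕ} {Z : ℝ → ℝ} {b : ℝ} (hZ : ContDiff ℝ (⊤ : ℕ∞) Z)
    (hb : Function.support Z ⊆ Icc 1 b) :
    ContDiff ℝ (⊤ : ℕ∞) (fun x : Euc n => Z (log ‖x‖)) ∧
      HasCompactSupport (fun x : Euc n => Z (log ‖x‖)) ∧
      tsupport (fun x : Euc n => Z (log ‖x‖)) ⊆ {0}ᶜ := by
  have hsub : tsupport (fun x : Euc n => Z (log ‖x‖)) ⊆ {x | exp 1 ≤ ‖x‖ ∧ ‖x‖ ≤ exp b} := by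
    refine closure_minimal (fun x hx => ?_) ((isClosed_le continuous_const continuous_norm).inter
      (isClosed_le continuous_norm continuous_const))
    have h := hb (show log ‖x‖ ∈ Function.support Z from hx)
    have hx0 : 0 < ‖x‖ := by
      refine (norm_nonneg x).lt_of_ne' fun h0 => ?_
      have := h.1
      rw [h0, Real.log_zero] at this
      linarith
    exact ⟨(Real.le_log_iff_exp_le hx0).1 h.1, (Real.log_le_iff_le_exp hx0).1 h.2⟩
  have hne : tsupport (fun x : Euc n => Z (log ‖x‖)) ⊆ {0}ᶜ := fun x hx h0 => by
    have := (hsub hx).1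
    rw [mem_singleton_iff.1 h0, norm_zero] at this
    exact absurd this (not_le.2 (exp_pos 1))
  refine ⟨contDiff_of_contDiffAt_tsupport fun x hx => ?_, ?_, hne⟩
  · have hx0 : x ≠ 0 := hne hx
    exact hZ.contDiffAt.comp x ((contDiffAt_norm ℝ hx0).log (norm_ne_zero_iff.2 hx0))
  · refine (isCompact_closedBall (0 : Euc n) (exp b)).of_isClosed_subset (isClosed_tsupport _)
      fun x hx => ?_
    simpa using (hsub hx).2

/-- Euler's identity for homogeneous functions. -/
theorem fderiv_self_of_homogeneous {E F : Type*} [NormedAddCommGroup E] [NormedSpace ℝ E]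
    [NormedAddCommGroup F] [NormedSpace ℝ F] {f : E → F} {a : ℝ}
    (hf : ∀ t : ℝ, 0 < t → ∀ x, f (t • x) = t ^ a • f x) {x : E} (hd : DifferentiableAt ℝ f x) :
    fderiv ℝ f x x = a • f x := by
  have h1 : HasDerivAt (fun t : ℝ => t • x) x 1 := by
    simpa using (hasDerivAt_id (1 : ℝ)).smul_const x
  have h2 : HasDerivAt (fun t : ℝ => f (t • x)) (fderiv ℝ f x x) 1 := by
    have : HasFDerivAt f (fderiv ℝ f x) ((1 : ℝ) • x) := by simpa using hd.hasFDerivAt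
    exact this.comp_hasDerivAt 1 h1
  have h3 : HasDerivAt (fun t : ℝ => t ^ a • f x) (a • f x) 1 := by
    simpa using (Real.hasDerivAt_rpow_const (x := 1) (p := a) (Or.inl one_ne_zero)).smul_const (f x)
  refine h2.unique (h3.congr_of_eventuallyEq ?_)
  filter_upwards [lt_mem_nhds (zero_lt_one' ℝ)] with t ht using hf t ht x

/-- Testing the stability inequality with `Z(log ‖x‖) u` and comparing the Dirichlet energy with
its radial part. -/
theorem Stable1.radial_inequality {n m : ℕ} {p : ℝ} (hp : 1 < p)
    {u : Euc n → EuclideanSpace ℝ (Fin m)} (hreg : ContDiffOn ℝ 2 u {(0 : Euc n)}ᶜ) {α : ℝ}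
    (hhom : ∀ t : ℝ, 0 < t → ∀ x : Euc n, u (t • x) = t ^ (-α) • u x)
    (hsol : ∀ (i : Fin m), ∀ x : Euc n, x ≠ 0 →
      - lap (fun z => u z i) x = ‖u x‖ ^ (p - 1) * u x i)
    (hstab : Stable1 n m p u {(0 : Euc n)}ᶜ) {Z : ℝ → ℝ} {b : ℝ}
    (hZ : ContDiff ℝ (⊤ : ℕ∞) Z) (hb : Function.support Z ⊆ Icc 1 b) :
    (p - 1) * ∫ x, ‖u x‖ ^ 2 * ((deriv Z (log ‖x‖) - α * Z (log ‖x‖)) ^ 2 / ‖x‖ ^ 2) ≤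
      p * ∫ x, ‖u x‖ ^ 2 * (deriv Z (log ‖x‖) ^ 2 / ‖x‖ ^ 2) := by
  obtain ⟨hζ, hc, hζU⟩ := contDiff_comp_log_norm (n := n) hZ hb
  have hZd : Differentiable ℝ Z := hZ.differentiable (by simp)
  set ζ : Euc n → ℝ := fun x => Z (log ‖x‖) with hζdef
  have hU : IsOpen ({0}ᶜ : Set (Euc n)) := isOpen_compl_singleton
  have hζ2 : ContDiff ℝ 2 ζ := contDiff_infty.1 hζ 2
  have hui : ∀ i, ContDiffOn ℝ 2 (fun z => u z i) {(0 : Euc n)}ᶜ := fun i =>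
    contDiffOn_euclidean.1 hreg i
  have hζ0 : ∀ x ∉ tsupport ζ, ζ x = 0 := fun x hx => image_eq_zero_of_notMem_tsupport hx
  have h0 : (0 : Euc n) ∉ tsupport ζ := fun h => hζU h rfl
  have hφsupp : ∀ i, tsupport (fun y => ζ y * u y i) ⊆ tsupport ζ := fun i =>
    tsupport_mul_subset_left
  have hφc : ∀ i, HasCompactSupport (fun y => ζ y * u y i) := fun i => hc.mul_right
  have hφd : ∀ i, ContDiff ℝ 1 (fun y => ζ y * u y i) := fun i =>
    contDiff_of_contDiffAt_tsupport fun x hx =>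
      (hζ2.contDiffAt.mul ((hui i).contDiffAt
        (hU.mem_nhds (hζU (hφsupp i hx))))).of_le (by norm_num)
  have hstab' := hstab.le_of_contDiff_one hp hU hreg.continuousOn hφd hφc
    fun i => (hφsupp i).trans hζU
  have huc : ContinuousOn u (tsupport ζ) := hreg.continuousOn.mono hζU
  have huic : ∀ i, ContinuousOn (fun z => u z i) (tsupport ζ) := fun i =>
    (hui i).continuousOn.mono hζU
  have hrpow : ContinuousOn (fun x => ‖u x‖ ^ (p - 1)) (tsupport ζ) :=
    huc.norm.rpow_const fun _ _ => Or.inr (by linarith)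
  have hζc : ContinuousOn ζ (tsupport ζ) := hζ.continuous.continuousOn
  set A := ∫ x, ζ x ^ 2 * (‖u x‖ ^ (p - 1) * ‖u x‖ ^ 2) with hA
  have hgradζ : ∀ x, x ≠ 0 → ‖gradient ζ x‖ ^ 2 = deriv Z (log ‖x‖) ^ 2 / ‖x‖ ^ 2 :=
    fun x hx => norm_gradient_comp_log_norm_sq hx (hZd _)
  have hgrad0 : gradient ζ (0 : Euc n) = 0 := by
    rw [← norm_eq_zero, norm_gradient_eq_norm_fderiv, fderiv_of_notMem_tsupport ℝ h0, norm_zero]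
  have hE : ∀ i, ∫ x, ‖gradient (fun y => ζ y * u y i) x‖ ^ 2 =
      (∫ x, ‖u x‖ ^ (p - 1) * (ζ x * u x i) ^ 2) +
        ∫ x, u x i ^ 2 * ‖gradient ζ x‖ ^ 2 := fun i => by
    rw [integral_norm_gradient_mul_sq hU hζ2 hc hζU (hui i)]
    congr 2 with x
    rcases eq_or_ne x 0 with rfl | hx
    · simp [hζ0 0 h0]
    · rw [hsol i x hx]
      ring
  have iA : ∀ i, Integrable fun x => ‖u x‖ ^ (p - 1) * (ζ x * u x i) ^ 2 := fun i =>
    integrable_of_continuousOn_compact hc.isCompact (hrpow.mul ((hζc.mul (huic i)).pow 2))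
      fun x hx => by simp [hζ0 x hx]
  have hA1 : ∑ i, ∫ x, ‖u x‖ ^ (p - 1) * (ζ x * u x i) ^ 2 = A := by
    rw [← integral_finsetSum _ fun i _ => iA i, hA]
    congr 1 with x
    rw [EuclideanSpace.real_norm_sq_eq, Finset.mul_sum, Finset.mul_sum]
    exact Finset.sum_congr rfl fun i _ => by ring
  have hA2 : ∑ i, ∑ j, ∫ x, ‖u x‖ ^ (p - 3) * u x i * u x j * (ζ x * u x i) * (ζ x * u x j)
      = A := by
    have iij : ∀ i j, Integrable
        fun x => ‖u x‖ ^ (p - 3) * u x i * u x j * (ζ x * u x i) * (ζ x * u x j) := fun i j =>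
      integrable_of_continuousOn_compact hc.isCompact
        ((((continuous_norm_rpow_mul_mul hp i j).comp_continuousOn huc).mul
          (hζc.mul (huic i))).mul (hζc.mul (huic j))) fun x hx => by simp [hζ0 x hx]
    have : ∀ i, ∑ j, ∫ x, ‖u x‖ ^ (p - 3) * u x i * u x j * (ζ x * u x i) * (ζ x * u x j) =
        ∫ x, ∑ j, ‖u x‖ ^ (p - 3) * u x i * u x j * (ζ x * u x i) * (ζ x * u x j) := fun i =>
      (integral_finsetSum _ fun j _ => iij i j).symm
    simp_rw [this]
    rw [← integral_finsetSum _ fun i _ => integrable_finsetSum _ fun j _ => iij i j, hA]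
    congr 1 with x
    have h1 : ∑ i, ∑ j, ‖u x‖ ^ (p - 3) * u x i * u x j * (ζ x * u x i) * (ζ x * u x j) =
        ‖u x‖ ^ (p - 3) * ζ x ^ 2 * ((∑ i, u x i ^ 2) * ∑ j, u x j ^ 2) := by
      rw [Finset.sum_mul_sum, Finset.mul_sum]
      refine Finset.sum_congr rfl fun i _ => ?_
      rw [Finset.mul_sum]
      exact Finset.sum_congr rfl fun j _ => by ring
    rw [h1, ← EuclideanSpace.real_norm_sq_eq]
    rcases eq_or_ne (u x) 0 with hx | hx
    · simp [hx]
    · have hx' : 0 < ‖u x‖ := norm_pos_iff.2 hx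
      have h2 : ‖u x‖ ^ (p - 1) = ‖u x‖ ^ (p - 3) * ‖u x‖ ^ 2 := by
        rw [← Real.rpow_natCast, ← Real.rpow_add hx']
        norm_num
        ring_nf
      rw [h2]
      ring
  set B := ∫ x, ‖u x‖ ^ 2 * (deriv Z (log ‖x‖) ^ 2 / ‖x‖ ^ 2) with hB
  have hB1 : ∑ i, ∫ x, u x i ^ 2 * ‖gradient ζ x‖ ^ 2 = B := by
    have iB : ∀ i, Integrable fun x => u x i ^ 2 * ‖gradient ζ x‖ ^ 2 := fun i => by
      simp_rw [norm_gradient_eq_norm_fderiv]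
      refine integrable_of_continuousOn_compact hc.isCompact (((huic i).pow 2).mul
        ((hζ.continuous_fderiv (by simp)).norm.pow 2).continuousOn) fun x hx => ?_
      simp [fderiv_of_notMem_tsupport ℝ hx]
    rw [← integral_finsetSum _ fun i _ => iB i, hB]
    congr 1 with x
    rw [← Finset.sum_mul, ← EuclideanSpace.real_norm_sq_eq]
    rcases eq_or_ne x 0 with rfl | hx
    · simp [hgrad0]
    · rw [hgradζ x hx]
  have hD : ∑ i, ∫ x, ‖gradient (fun y => ζ y * u y i) x‖ ^ 2 = A + B := by
    simp_rw [hE]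
    rw [Finset.sum_add_distrib, hA1, hB1]
  have hC : ∫ x, ‖u x‖ ^ 2 * ((deriv Z (log ‖x‖) - α * Z (log ‖x‖)) ^ 2 / ‖x‖ ^ 2) ≤ A + B := by
    have iD : ∀ i, Integrable fun x => ‖gradient (fun y => ζ y * u y i) x‖ ^ 2 := fun i => by
      simp_rw [norm_gradient_eq_norm_fderiv]
      refine integrable_of_continuousOn_compact (hφc i).isCompact
        (((hφd i).continuous_fderiv one_ne_zero).norm.pow 2).continuousOn fun x hx => ?_
      simp [fderiv_of_notMem_tsupport ℝ hx]
    rw [← hD, ← integral_finsetSum _ fun i _ => iD i]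
    refine integral_mono_of_nonneg (.of_forall fun x => by positivity)
      (integrable_finsetSum _ fun i _ => iD i) (.of_forall fun x => ?_)
    rcases eq_or_ne x 0 with rfl | hx
    · simp only [norm_zero, ne_eq, OfNat.ofNat_ne_zero, not_false_eq_true, zero_pow, div_zero,
        mul_zero]
      positivity
    · simp only
      rw [EuclideanSpace.real_norm_sq_eq (u x), Finset.sum_mul]
      refine Finset.sum_le_sum fun i _ => (sq_fderiv_self_div_le _ x).trans' (le_of_eq ?_)
      have hx' : ‖x‖ ≠ 0 := norm_ne_zero_iff.2 hx
      have d1 : HasFDerivAt ζ _ x := hasFDerivAt_comp_log_norm hx (hZd _)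
      have hd : DifferentiableAt ℝ (fun z => u z i) x :=
        ((hui i).contDiffAt (hU.mem_nhds hx)).differentiableAt (by norm_num)
      have heuler : fderiv ℝ (fun z => u z i) x x = -α * u x i :=
        fderiv_self_of_homogeneous (fun t ht y => by rw [hhom t ht y]; rfl) hd
      rw [HasFDerivAt.fderiv (f := fun y => ζ y * u y i) (d1.mul hd.hasFDerivAt)]
      simp only [add_apply, smul_apply,
        heuler, innerSL_apply_apply, real_inner_self_eq_norm_sq, smul_eq_mul, hζdef]
      field_simp
      ring
  rw [hD, hA1, hA2] at hstab'
  nlinarith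

/-- Theorem 2.4: classification of stable homogeneous solutions of the second order
Lane–Emden system.  A homogeneous map `u_i(x) = |x|^{−2/(p−1)} ψ_i(x/|x|)` (with
`ψ = (ψ_i)` of class `C²` on the sphere, encoded by `u` being `C²` away from the origin
and homogeneous of degree `−2/(p−1)`) which solves `−Δu_i = |u|^{p−1} u_i` on `ℝⁿ∖{0}`
and is stable with respect to test functions in `C_c^∞(ℝⁿ∖{0})` must vanish
(i.e. `ψ_i ≡ 0` for every `i`), provided `(n+2)/(n−2) < p < p_c(n)`. -/
theorem statement8 (n m : ℕ) (hn : 3 ≤ n) (hm : 1 ≤ m) (p : ℝ)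
    (hp1 : ((n : ℝ) + 2) / ((n : ℝ) - 2) < p)
    (hp2 : 11 ≤ n →
      p < (((n : ℝ) - 2) ^ 2 - 4 * (n : ℝ) + 8 * Real.sqrt ((n : ℝ) - 1)) /
          (((n : ℝ) - 2) * ((n : ℝ) - 10)))
    (u : Euc n → EuclideanSpace ℝ (Fin m))
    (hreg : ContDiffOn ℝ 2 u {(0 : Euc n)}ᶜ)
    (hhom : ∀ t : ℝ, 0 < t → ∀ x : Euc n, u (t • x) = t ^ (-(2 / (p - 1))) • u x)
    (hsol : ∀ (i : Fin m), ∀ x : Euc n, x ≠ 0 →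
      - lap (fun z => u z i) x = ‖u x‖ ^ (p - 1) * u x i)
    (hstab : Stable1 n m p u {(0 : Euc n)}ᶜ) :
    ∀ x : Euc n, x ≠ 0 → u x = 0 := by

  have hn3 : (3 : ℝ) ≤ n := by exact_mod_cast hn
  have hp : 1 < p := by
    refine lt_of_le_of_lt ?_ hp1
    rw [le_div_iff₀ (by linarith)]
    linarith
  have hJL := joseph_lundgren hn hp1 hp2
  set α := 2 / (p - 1) with hα
  set κ := ((n : ℝ) - 2) / 2 with hκ
  obtain ⟨γ, hγ⟩ : ∃ γ, γ = κ - α := ⟨_, rfl⟩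
  rw [← hγ] at hJL
  intro x₀ hx₀
  by_contra hux₀
  obtain ⟨η, b, hη, hb, hP, hQ⟩ := exists_slow_bump (sub_pos.2 hJL)
  have hηd : Differentiable ℝ η := hη.differentiable (by simp)
  have hηc : HasCompactSupport η := HasCompactSupport.of_support_subset_isCompact isCompact_Icc hb
  let W : Euc n → ℝ := fun x => ‖u x‖ ^ 2 * (‖x‖ ^ (-(2 * γ)) / ‖x‖ ^ 2)
  have hfr : Module.finrank ℝ (Euc n) = n := finrank_euclideanSpace_fin
  have : Nontrivial (Euc n) := Module.nontrivial_of_finrank_pos (R := ℝ) (by omega)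
  have hW : ∀ t : ℝ, 0 < t → ∀ x, W (t • x) = t ^ (-(Module.finrank ℝ (Euc n) : ℝ)) * W x := by
    intro t ht x
    have h1 : (t ^ (-α)) ^ 2 * t ^ (-(2 * γ)) = t ^ (-(n : ℝ)) * t ^ 2 := by
      rw [← Real.rpow_natCast, ← Real.rpow_natCast, ← Real.rpow_mul ht.le, ← Real.rpow_add ht,
        ← Real.rpow_add ht]
      congr 1
      push_cast
      linarith
    have h2 : t ^ (-(n : ℝ)) = (t ^ (-α)) ^ 2 * t ^ (-(2 * γ)) / t ^ 2 := by
      rw [h1]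
      field_simp
    simp only [W]
    rw [hfr, h2, hhom t ht x, norm_smul, norm_smul, Real.norm_of_nonneg ht.le,
      Real.norm_of_nonneg (Real.rpow_nonneg ht.le _), Real.mul_rpow ht.le (norm_nonneg _)]
    ring
  obtain ⟨M, hM⟩ := exists_integral_homogeneous_mul_log (volume : Measure (Euc n)) hW
  let Z : ℝ → ℝ := fun s => exp (-γ * s) * η s
  have hZ : ContDiff ℝ (⊤ : ℕ∞) Z := (contDiff_const.mul contDiff_id).exp.mul hη
  have hZb : Function.support Z ⊆ Icc 1 b := fun s hs => hb fun h => hs (by simp [Z, h])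
  have hZ' : ∀ s, deriv Z s = exp (-γ * s) * (deriv η s - γ * η s) := fun s => by
    have h1 : HasDerivAt (fun s => exp (-γ * s)) (exp (-γ * s) * -γ) s := by
      simpa using ((hasDerivAt_id s).const_mul (-γ)).exp
    rw [HasDerivAt.deriv (f := Z) (h1.mul (hηd s).hasDerivAt)]
    ring
  have hexp : ∀ x : Euc n, x ≠ 0 → exp (-γ * log ‖x‖) ^ 2 = ‖x‖ ^ (-(2 * γ)) := fun x hx => by
    rw [← Real.exp_nat_mul, Real.rpow_def_of_pos (norm_pos_iff.2 hx)]
    congr 1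
    push_cast
    ring
  have hmul : ∀ (c : ℝ) (x : Euc n),
      ‖u x‖ ^ 2 * ((exp (-γ * log ‖x‖) * c) ^ 2 / ‖x‖ ^ 2) = W x * c ^ 2 := fun c x => by
    rcases eq_or_ne x 0 with rfl | hx
    · simp [W]
    · simp only [W]
      rw [mul_pow, hexp x hx]
      ring
  have hineq := hstab.radial_inequality hp hreg hhom hsol hZ hZb
  have e1 : ∀ s, deriv Z s - α * Z s = exp (-γ * s) * (deriv η s - κ * η s) := fun s => by
    rw [hZ' s]
    simp only [Z]
    rw [show κ = γ + α by linarith]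
    ring
  simp_rw [e1, hZ', hmul] at hineq
  rw [hM fun s => (deriv η s - κ * η s) ^ 2, hM fun s => (deriv η s - γ * η s) ^ 2,
    integral_deriv_sub_smul_sq (hη.of_le (by exact_mod_cast le_top)) hηc,
    integral_deriv_sub_smul_sq (hη.of_le (by exact_mod_cast le_top)) hηc] at hineq
  have hMpos : 0 < M := by
    obtain ⟨hζ, hc, hζU⟩ := contDiff_comp_log_norm (n := n) hZ hZb
    set ζ : Euc n → ℝ := fun x => Z (log ‖x‖) with hζdef
    have h0 : ζ 0 = 0 := image_eq_zero_of_notMem_tsupport fun h => hζU h rfl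
    obtain ⟨s, hs⟩ : ∃ s, η s ≠ 0 := by
      by_contra! h
      simp [h] at hP
    have hGsupp : tsupport (fun x => ζ x ^ 2 * ‖u x‖ ^ 2) ⊆ tsupport ζ :=
      closure_mono fun x hx h => hx (by simp [h])
    have hG : Continuous fun x => ζ x ^ 2 * ‖u x‖ ^ 2 :=
      (contDiff_of_contDiffAt_tsupport (k := 0) fun x hx =>
        ((hζ.contDiffAt.pow 2).of_le (by simp)).mul (((hreg.contDiffAt
          (isOpen_compl_singleton.mem_nhds (hζU (hGsupp hx)))).norm_sq ℝ).of_le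
            (by simp))).continuous
    have hx₀' : 0 < ‖x₀‖ := norm_pos_iff.2 hx₀
    have hr : 0 < exp s / ‖x₀‖ := by positivity
    have hpos : 0 < ∫ x, ζ x ^ 2 * ‖u x‖ ^ 2 := by
      refine hG.integral_pos_of_hasCompactSupport_nonneg_nonzero
        (hc.of_isClosed_subset (isClosed_tsupport _) hGsupp) (fun x => by positivity)
        (x := (exp s / ‖x₀‖) • x₀) ?_
      have hnorm : ‖(exp s / ‖x₀‖) • x₀‖ = exp s := by
        rw [norm_smul, Real.norm_of_nonneg hr.le]
        field_simp
      have h1 : ζ ((exp s / ‖x₀‖) • x₀) ≠ 0 := by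
        simp [hζdef, hnorm, Z, hs]
      have h2 : u ((exp s / ‖x₀‖) • x₀) ≠ 0 := by
        rw [hhom _ hr]
        exact smul_ne_zero (Real.rpow_pos_of_pos hr _).ne' hux₀
      positivity
    have h3 : ∀ x, ζ x ^ 2 * ‖u x‖ ^ 2 = W x * (exp (log ‖x‖) * η (log ‖x‖)) ^ 2 := fun x => by
      rcases eq_or_ne x 0 with rfl | hx
      · simp [h0, W]
      · have hx' : 0 < ‖x‖ := norm_pos_iff.2 hx
        simp only [hζdef, Z, W]
        rw [mul_pow, hexp x hx, Real.exp_log hx']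
        field_simp
    simp_rw [h3] at hpos
    rw [hM fun s => (exp s * η s) ^ 2] at hpos
    have hnn : 0 ≤ ∫ s, (exp s * η s) ^ 2 := integral_nonneg fun s => sq_nonneg _
    exact pos_of_mul_pos_left hpos hnn
  have hfin : (p - 1) * ((∫ s, deriv η s ^ 2) + κ ^ 2 * ∫ s, η s ^ 2) ≤
      p * ((∫ s, deriv η s ^ 2) + γ ^ 2 * ∫ s, η s ^ 2) := by
    refine le_of_mul_le_mul_left ?_ hMpos
    linarith
  linarith
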